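/- There exists a subgroup G ≤ W isomorphic to the symmetric group S₃ such that: the action of G on the 56 exceptional classes has exactly ten orbits, one of length 2 (with point stabilizer cyclic of order 3) and nine of length 6 (with trivial point stabilizers); G is minimal; G fixes a conic class; and G satisfies condition (H1). -/

import Mathlib

open scoped BigOperators

noncomputable section

/-- The Picard lattice of a degree 2 del Pezzo surface. -/
abbrev V : Type := Fin 8 → ℤ

/-- The intersection form. -/
def bil (x y : V) : ℤ := x 0 * y 0 - ∑ i ∈ Finset.Ioi (0 : Fin 8), x i * y i

/-- The canonical class. -/
def Kvec : V := fun i => if i = 0 then -3 else 1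

abbrev LatAut := V ≃ₗ[ℤ] V

/-- The Weyl group: automorphisms preserving the form and fixing K. -/
def W : Subgroup LatAut where
  carrier := {g | (∀ x y, bil (g x) (g y) = bil x y) ∧ g Kvec = Kvec}
  one_mem' := ⟨fun _ _ => rfl, rfl⟩
  mul_mem' := by
    rintro a b ⟨ha1, ha2⟩ ⟨hb1, hb2⟩
    refine ⟨fun x y => ?_, ?_⟩
    · show bil (a (b x)) (a (b y)) = bil x y
      rw [ha1, hb1]
    · show a (b Kvec) = Kvec
      rw [hb2, ha2]
  inv_mem' := by
    rintro a ⟨ha1, ha2⟩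
    refine ⟨fun x y => ?_, ?_⟩
    · have h := ha1 (a⁻¹ x) (a⁻¹ y)
      have hx : a (a⁻¹ x) = x := a.apply_symm_apply x
      have hy : a (a⁻¹ y) = y := a.apply_symm_apply y
      rw [hx, hy] at h
      exact h.symm
    · have h2 : a.symm (a Kvec) = a.symm Kvec := by rw [ha2]
      rw [a.symm_apply_apply] at h2
      exact (show a⁻¹ Kvec = a.symm Kvec from rfl).trans h2.symm

/-- Exceptional classes. -/
def Exc : Set V := {E | bil E E = -1 ∧ bil E Kvec = -1}

/-- Conic classes. -/
def IsConic (C : V) : Prop := bil C C = 0 ∧ bil C Kvec = -2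

/-- The orbit of a vector under a subgroup of `LatAut`. -/
def orb (G : Subgroup LatAut) (E : V) : Set V := {v | ∃ g ∈ G, g E = v}

/-- The set of orbits of exceptional classes. -/
def orbs (G : Subgroup LatAut) : Set (Set V) := {S | ∃ E ∈ Exc, S = orb G E}

/-- The stabilizer of a vector, as a subgroup of `LatAut`. -/
def stab (G : Subgroup LatAut) (E : V) : Subgroup LatAut where
  carrier := {g | g ∈ G ∧ g E = E}
  one_mem' := ⟨G.one_mem, rfl⟩
  mul_mem' := by
    rintro a b ⟨haG, ha⟩ ⟨hbG, hb⟩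
    exact ⟨G.mul_mem haG hbG, by show a (b E) = E; rw [hb, ha]⟩
  inv_mem' := by
    rintro a ⟨haG, ha⟩
    refine ⟨G.inv_mem haG, ?_⟩
    conv_lhs => rw [← ha]
    exact a.symm_apply_apply E

/-- `G` is minimal: no nonempty orbit of exceptional classes consists of pairwise
orthogonal classes. -/
def MinimalAction (G : Subgroup LatAut) : Prop :=
  ∀ E ∈ Exc, ¬ (∀ E₁ ∈ orb G E, ∀ E₂ ∈ orb G E, E₁ ≠ E₂ → bil E₁ E₂ = 0)

/-- The natural representation of a subgroup of `LatAut` on the lattice. -/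
def rep (G : Subgroup LatAut) : Representation ℤ G V where
  toFun g := (g : LatAut).toLinearMap
  map_one' := rfl
  map_mul' _ _ := rfl

/-- Condition (H1): the first group cohomology of every subgroup of `G`
with coefficients in the lattice vanishes. -/
def CondH1 (G : Subgroup LatAut) : Prop :=
  ∀ G' : Subgroup LatAut, G' ≤ G →
    Subsingleton (groupCohomology.H1 (Rep.of (rep G')))

open Equiv in
/-- The permutation action of `S₃` on the lattice: it permutes the classes `e₁, e₂, e₃` and
`e₄, e₅, e₆` simultaneously. -/
def permAct (σ : Perm (Fin 3)) (x : V) : V :=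
  ![x 0, x (![1, 2, 3] (σ⁻¹ 0)), x (![1, 2, 3] (σ⁻¹ 1)), x (![1, 2, 3] (σ⁻¹ 2)),
    x (![4, 5, 6] (σ⁻¹ 0)), x (![4, 5, 6] (σ⁻¹ 1)), x (![4, 5, 6] (σ⁻¹ 2)), x 7]

/-- The involution fixing `K` and the conic class `F = (1, 0, …, 0, -1)` which swaps the two
components `eᵢ` and `F - eᵢ` of each singular fibre, `1 ≤ i ≤ 6`. -/
def fibreSwap (x : V) : V :=
  ![4 * x 0 + (x 1 + x 2 + x 3 + x 4 + x 5 + x 6) + 3 * x 7,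
    -x 0 - x 7 - x 1, -x 0 - x 7 - x 2, -x 0 - x 7 - x 3,
    -x 0 - x 7 - x 4, -x 0 - x 7 - x 5, -x 0 - x 7 - x 6,
    -3 * x 0 - (x 1 + x 2 + x 3 + x 4 + x 5 + x 6) - 2 * x 7]

open Equiv in
/-- The action of `S₃`: the permutation action, twisted by `fibreSwap` on odd permutations. -/
def twistedAct (σ : Perm (Fin 3)) (x : V) : V :=
  if Perm.sign σ = 1 then permAct σ x else fibreSwap (permAct σ x)

lemma bil_eq (x y : V) : bil x y = x 0 * y 0 - (x 1 * y 1 + x 2 * y 2 + x 3 * y 3 + x 4 * y 4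
    + x 5 * y 5 + x 6 * y 6 + x 7 * y 7) := by
  have : Finset.Ioi (0 : Fin 8) = {1, 2, 3, 4, 5, 6, 7} := by decide
  simp [bil, this, add_assoc]

lemma permAct_fst (σ : Equiv.Perm (Fin 3)) (x : V) (k : Fin 3) :
    permAct σ x (![1, 2, 3] k) = x (![1, 2, 3] (σ⁻¹ k)) := by
  fin_cases k <;> rfl

lemma permAct_snd (σ : Equiv.Perm (Fin 3)) (x : V) (k : Fin 3) :
    permAct σ x (![4, 5, 6] k) = x (![4, 5, 6] (σ⁻¹ k)) := by
  fin_cases k <;> rfl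

lemma permAct_mul (σ τ : Equiv.Perm (Fin 3)) (x : V) :
    permAct (σ * τ) x = permAct σ (permAct τ x) := by
  conv_rhs => rw [permAct]
  simp only [permAct_fst, permAct_snd]
  rfl

lemma fibreSwap_fibreSwap (x : V) : fibreSwap (fibreSwap x) = x := by
  ext i
  fin_cases i <;> simp [fibreSwap] <;> ring

lemma permAct_fibreSwap (σ : Equiv.Perm (Fin 3)) (x : V) :
    permAct σ (fibreSwap x) = fibreSwap (permAct σ x) := by
  have h1 : ∀ k : Fin 3, fibreSwap x (![1, 2, 3] k) = -x 0 - x 7 - x (![1, 2, 3] k) := by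
    intro k; fin_cases k <;> rfl
  have h2 : ∀ k : Fin 3, fibreSwap x (![4, 5, 6] k) = -x 0 - x 7 - x (![4, 5, 6] k) := by
    intro k; fin_cases k <;> rfl
  have s1 := Equiv.sum_comp σ⁻¹ fun k => x (![1, 2, 3] k)
  have s2 := Equiv.sum_comp σ⁻¹ fun k => x (![4, 5, 6] k)
  simp only [Fin.sum_univ_three] at s1 s2
  rw [permAct, h1, h1, h1, h2, h2, h2]
  ext i
  fin_cases i <;> simp [fibreSwap, permAct] at s1 s2 ⊢ <;> linarith

lemma twistedAct_mul (σ τ : Equiv.Perm (Fin 3)) (x : V) :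
    twistedAct (σ * τ) x = twistedAct σ (twistedAct τ x) := by
  rcases Int.units_eq_one_or (Equiv.Perm.sign σ) with hσ | hσ <;>
  rcases Int.units_eq_one_or (Equiv.Perm.sign τ) with hτ | hτ <;>
  simp [twistedAct, hσ, hτ, permAct_mul, permAct_fibreSwap, fibreSwap_fibreSwap]

lemma twistedAct_one (x : V) : twistedAct 1 x = x := by
  ext i
  simp only [twistedAct, map_one, if_true]
  fin_cases i <;> rfl

/-- The twisted action of `S₃` as a homomorphism to the automorphism group of the lattice. -/
def twistedHom : Equiv.Perm (Fin 3) →* LatAut where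
  toFun σ :=
    { toFun := twistedAct σ
      invFun := twistedAct σ⁻¹
      left_inv := fun x => by rw [← twistedAct_mul, inv_mul_cancel, twistedAct_one]
      right_inv := fun x => by rw [← twistedAct_mul, mul_inv_cancel, twistedAct_one]
      map_add' := fun x y => by
        ext i
        unfold twistedAct
        split_ifs <;> fin_cases i <;> simp [fibreSwap, permAct] <;> ring
      map_smul' := fun c x => by
        ext i
        unfold twistedAct
        split_ifs <;> fin_cases i <;> simp [fibreSwap, permAct] <;> ring }
  map_one' := LinearEquiv.ext twistedAct_one
  map_mul' σ τ := LinearEquiv.ext (twistedAct_mul σ τ)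

lemma twistedHom_apply (σ : Equiv.Perm (Fin 3)) (x : V) : twistedHom σ x = twistedAct σ x := rfl

lemma bil_twistedAct (σ : Equiv.Perm (Fin 3)) (x y : V) :
    bil (twistedAct σ x) (twistedAct σ y) = bil x y := by
  have hp : bil (permAct σ x) (permAct σ y) = bil x y := by
    have s1 := Equiv.sum_comp σ⁻¹ fun k => x (![1, 2, 3] k) * y (![1, 2, 3] k)
    have s2 := Equiv.sum_comp σ⁻¹ fun k => x (![4, 5, 6] k) * y (![4, 5, 6] k)
    simp only [Fin.sum_univ_three] at s1 s2
    simp [bil_eq, permAct] at s1 s2 ⊢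
    linarith
  have hf : ∀ x y, bil (fibreSwap x) (fibreSwap y) = bil x y := by
    intro x y
    simp [bil_eq, fibreSwap]
    ring
  unfold twistedAct
  split_ifs
  · exact hp
  · rw [hf, hp]

lemma twistedAct_Kvec (σ : Equiv.Perm (Fin 3)) : twistedAct σ Kvec = Kvec := by
  revert σ; decide +kernel

lemma twistedHom_injective : Function.Injective twistedHom := by
  have h : ∀ σ : Equiv.Perm (Fin 3), twistedAct σ (Pi.single 1 1) = Pi.single 1 1 →
      twistedAct σ (Pi.single 2 1) = Pi.single 2 1 → σ = 1 := by decide +kernel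
  refine (injective_iff_map_eq_one _).2 fun σ hσ => h σ ?_ ?_ <;>
  simp [← twistedHom_apply, hσ]

/-- Representatives of the ten orbits of exceptional classes. -/
def orbitRep : Fin 10 → V :=
  ![![0, 0, 0, 0, 0, 0, 0, 1],
    ![0, 1, 0, 0, 0, 0, 0, 0],
    ![0, 0, 0, 0, 1, 0, 0, 0],
    ![1, 0, 0, 0, 0, -1, -1, 0],
    ![1, 0, 0, -1, 0, 0, -1, 0],
    ![1, 0, 0, -1, 0, -1, 0, 0],
    ![1, 0, 0, -1, -1, 0, 0, 0],
    ![1, 0, -1, -1, 0, 0, 0, 0],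
    ![2, 0, -1, -1, -1, -1, -1, 0],
    ![2, -1, -1, -1, 0, -1, -1, 0]]

/-- The orbit of a lattice vector under the twisted action. -/
def orbFinset (E : V) : Finset V := Finset.univ.image fun σ => twistedAct σ E

lemma orb_range (E : V) : orb twistedHom.range E = orbFinset E := by
  ext v
  simp [orb, orbFinset, twistedHom_apply]

instance (E : V) : Decidable (E ∈ Exc) :=
  inferInstanceAs (Decidable (_ ∧ _))

lemma orbitRep_mem_Exc : ∀ k, orbitRep k ∈ Exc := by decide +kernel

lemma card_orbFinset_orbitRep :
    ∀ k, (orbFinset (orbitRep k)).card = if k = 0 then 2 else 6 := by decide +kernel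

lemma eq_of_orbitRep_mem :
    ∀ j k, orbitRep j ∈ orbFinset (orbitRep k) → j = k := by decide +kernel

lemma exists_bil_ne_zero : ∀ k, ∃ σ τ : Equiv.Perm (Fin 3),
    twistedAct σ (orbitRep k) ≠ twistedAct τ (orbitRep k) ∧
    bil (twistedAct σ (orbitRep k)) (twistedAct τ (orbitRep k)) ≠ 0 := by decide +kernel

/-- A vector of degree `c` whose other coordinates are `a` or `a - 1`. -/
def twoValued (c a : ℤ) (b : Fin 7 → Bool) : V := Fin.cons c fun i => if b i then a else a - 1

lemma exists_mem_orbFinset_of_twoValued :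
    ∀ c : Fin 4, ∀ b : Fin 7 → Bool, twoValued (c : ℕ) (![1, 0, 0, -1] c) b ∈ Exc →
      ∃ k, twoValued (c : ℕ) (![1, 0, 0, -1] c) b ∈ orbFinset (orbitRep k) := by decide +kernel

lemma eq_twoValued {E : V} {a : ℤ} (h : ∑ i : Fin 7, (E i.succ - a) * (E i.succ - (a - 1)) = 0) :
    ∃ b, E = twoValued (E 0) a b := by
  have hnn : ∀ i ∈ Finset.univ, 0 ≤ (E (Fin.succ i) - a) * (E (Fin.succ i) - (a - 1)) := by
    intro i _
    rcases le_or_gt a (E i.succ) with h | h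
    · exact mul_nonneg (by omega) (by omega)
    · exact mul_nonneg_of_nonpos_of_nonpos (by omega) (by omega)
  have h0 := (Finset.sum_eq_zero_iff_of_nonneg hnn).1 h
  refine ⟨fun i => E i.succ = a, ?_⟩
  ext i
  refine Fin.cases rfl (fun i => ?_) i
  rcases mul_eq_zero.1 (h0 i (Finset.mem_univ i)) with h | h <;>
  simp only [twoValued, Fin.cons_succ, decide_eq_true_eq] <;> split_ifs <;> omega

lemma exists_mem_orbFinset {E : V} (hE : E ∈ Exc) : ∃ k, E ∈ orbFinset (orbitRep k) := by
  obtain ⟨h1, h2⟩ := id hE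
  rw [bil_eq] at h1 h2
  simp [Kvec] at h2
  have hCS := sq_sum_le_card_mul_sum_sq (s := Finset.univ) (f := fun i : Fin 7 => E i.succ)
  simp [Fin.sum_univ_seven] at hCS
  rw [show E 1 + E 2 + E 3 + E 4 + E 5 + E 6 + E 7 = 1 - 3 * E 0 by linarith,
    show E 1 ^ 2 + E 2 ^ 2 + E 3 ^ 2 + E 4 ^ 2 + E 5 ^ 2 + E 6 ^ 2 + E 7 ^ 2 = E 0 ^ 2 + 1 by
      linarith] at hCS
  have hlo : 0 ≤ E 0 := by nlinarith
  have hhi : E 0 ≤ 3 := by nlinarith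
  obtain ⟨c, hc⟩ : ∃ c : Fin 4, E 0 = (c : ℕ) :=
    ⟨⟨(E 0).toNat, by omega⟩, by simp [hlo]⟩
  have hsum : ∑ i : Fin 7, (E i.succ - ![1, 0, 0, -1] c) * (E i.succ - (![1, 0, 0, -1] c - 1))
      = 0 := by
    simp [Fin.sum_univ_seven]
    fin_cases c <;> simp at hc ⊢ <;> rw [hc] at h1 h2 <;> linarith
  obtain ⟨b, hb⟩ := eq_twoValued hsum
  rw [hc] at hb
  rw [hb] at hE ⊢
  exact exists_mem_orbFinset_of_twoValued c b hE

lemma orb_eq_of_mem {G : Subgroup LatAut} {E E' : V} (h : E' ∈ orb G E) :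
    orb G E' = orb G E := by
  obtain ⟨g, hg, rfl⟩ := h
  ext v
  constructor
  · rintro ⟨k, hk, rfl⟩
    exact ⟨k * g, G.mul_mem hk hg, rfl⟩
  · rintro ⟨k, hk, rfl⟩
    refine ⟨k * g⁻¹, G.mul_mem hk (G.inv_mem hg), ?_⟩
    exact congrArg k (g.symm_apply_apply E)

lemma exists_orb_eq {E : V} (hE : E ∈ Exc) :
    ∃ k, orb twistedHom.range E = orb twistedHom.range (orbitRep k) := by
  obtain ⟨k, hk⟩ := exists_mem_orbFinset hE
  exact ⟨k, orb_eq_of_mem (by rw [orb_range]; exact hk)⟩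

lemma orbs_range :
    orbs twistedHom.range = Set.range fun k => orb twistedHom.range (orbitRep k) := by
  ext S
  constructor
  · rintro ⟨E, hE, rfl⟩
    obtain ⟨k, hk⟩ := exists_orb_eq hE
    exact ⟨k, hk.symm⟩
  · rintro ⟨k, rfl⟩
    exact ⟨_, orbitRep_mem_Exc k, rfl⟩

lemma orb_orbitRep_injective :
    Function.Injective fun k => orb twistedHom.range (orbitRep k) := by
  intro j k h
  apply eq_of_orbitRep_mem
  have : orbitRep j ∈ orb twistedHom.range (orbitRep j) := ⟨1, one_mem _, rfl⟩
  simp only at h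
  rw [h, orb_range] at this
  exact this

lemma ncard_orb_orbitRep (k : Fin 10) :
    (orb twistedHom.range (orbitRep k)).ncard = if k = 0 then 2 else 6 := by
  rw [orb_range, Set.ncard_coe_finset, card_orbFinset_orbitRep]

lemma ncard_orbs_with_ncard (n : ℕ) :
    {S ∈ orbs twistedHom.range | S.ncard = n}.ncard =
      (Finset.univ.filter fun k : Fin 10 => (if k = 0 then 2 else 6) = n).card := by
  rw [← Set.ncard_coe_finset, ← Set.ncard_image_of_injective _ orb_orbitRep_injective]
  congr 1
  ext S
  simp only [orbs_range, Set.mem_ofPred_eq, Set.mem_range, Set.mem_image, Finset.coe_filter,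
    Finset.mem_univ, true_and]
  constructor
  · rintro ⟨⟨k, rfl⟩, h⟩
    exact ⟨k, by rwa [ncard_orb_orbitRep] at h, rfl⟩
  · rintro ⟨k, h, rfl⟩
    exact ⟨⟨k, rfl⟩, by rwa [ncard_orb_orbitRep]⟩

lemma ncard_orb_mul_card_stab (G : Subgroup LatAut) (E : V) :
    (orb G E).ncard * Nat.card (stab G E) = Nat.card G := by
  have ho : orb G E = MulAction.orbit G E := by
    ext v
    exact ⟨fun ⟨g, hg, h⟩ => ⟨⟨g, hg⟩, h⟩, fun ⟨g, h⟩ => ⟨g, g.2, h⟩⟩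
  have hs : Nat.card (stab G E) = Nat.card (MulAction.stabilizer G E) :=
    Nat.card_congr
      { toFun := fun g => ⟨⟨g, g.2.1⟩, g.2.2⟩
        invFun := fun g => ⟨g.1, g.1.2, g.2⟩
        left_inv := fun _ => rfl
        right_inv := fun _ => rfl }
  rw [ho, hs, ← MulAction.index_stabilizer, Subgroup.index_mul_card]

lemma card_range_twistedHom : Nat.card twistedHom.range = 6 := by
  rw [← Nat.card_congr (MonoidHom.ofInjective twistedHom_injective).toEquiv,
    Nat.card_eq_fintype_card]
  rfl

lemma minimalAction_range : MinimalAction twistedHom.range := by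
  intro E hE h
  obtain ⟨k, hk⟩ := exists_orb_eq hE
  rw [hk] at h
  obtain ⟨σ, τ, hne, hb⟩ := exists_bil_ne_zero k
  exact hb (h _ ⟨_, ⟨σ, rfl⟩, rfl⟩ _ ⟨_, ⟨τ, rfl⟩, rfl⟩ hne)

lemma twistedAct_finRotate (x : V) :
    twistedAct (finRotate 3) x = ![x 0, x 3, x 1, x 2, x 6, x 4, x 5, x 7] := rfl

lemma twistedAct_swap_zero_one (x : V) : twistedAct (Equiv.swap 0 1) x =
    fibreSwap ![x 0, x 2, x 1, x 3, x 5, x 4, x 6, x 7] := rfl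

lemma twistedAct_swap_zero_two (x : V) : twistedAct (Equiv.swap 0 2) x =
    fibreSwap ![x 0, x 3, x 2, x 1, x 6, x 5, x 4, x 7] := rfl

lemma twistedAct_swap_one_two (x : V) : twistedAct (Equiv.swap 1 2) x =
    fibreSwap ![x 0, x 1, x 3, x 2, x 4, x 6, x 5, x 7] := rfl

lemma exists_finRotate_sub_eq {a : V} (ha : a + twistedAct (finRotate 3) a +
    twistedAct (finRotate 3) (twistedAct (finRotate 3) a) = 0) :
    ∃ v, twistedAct (finRotate 3) v - v = a := by
  refine ⟨![0, 0, -a 2, a 1, 0, -a 5, a 4, 0], ?_⟩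
  simp only [twistedAct_finRotate, funext_iff, Fin.forall_fin_succ] at ha ⊢
  simp [Matrix.vecHead, Matrix.vecTail] at ha ⊢
  omega

lemma exists_swap_sub_eq {τ : Equiv.Perm (Fin 3)} (hτ : Equiv.Perm.sign τ ≠ 1) {b : V}
    (hb : b + twistedAct τ b = 0) : ∃ v, twistedAct τ v - v = b := by
  have hcases : ∀ τ : Equiv.Perm (Fin 3), Equiv.Perm.sign τ ≠ 1 →
      τ = Equiv.swap 0 1 ∨ τ = Equiv.swap 0 2 ∨ τ = Equiv.swap 1 2 := by decide
  rcases hcases τ hτ with rfl | rfl | rfl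
  · refine ⟨![-b 3, b 3 - b 1, 0, 0, b 3 - b 4, 0, b 0 + b 1 + b 3 + b 4, 0], ?_⟩
    simp only [twistedAct_swap_zero_one, fibreSwap, funext_iff, Fin.forall_fin_succ] at hb ⊢
    simp at hb ⊢
    omega
  · refine ⟨![-b 2, b 2 - b 1, 0, 0, b 2 - b 4, b 0 + b 1 + b 2 + b 4, 0, 0], ?_⟩
    simp only [twistedAct_swap_zero_two, fibreSwap, funext_iff, Fin.forall_fin_succ] at hb ⊢
    simp at hb ⊢
    omega
  · refine ⟨![-b 1, 0, b 1 - b 2, 0, b 0 + b 1 + b 2 + b 5, b 1 - b 5, 0, 0], ?_⟩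
    simp only [twistedAct_swap_one_two, fibreSwap, funext_iff, Fin.forall_fin_succ] at hb ⊢
    simp at hb ⊢
    omega

lemma exists_invariant_swap_sub_eq {b : V} (hs : twistedAct (finRotate 3) b = b)
    (hb : b + twistedAct (Equiv.swap 0 1) b = 0) :
    ∃ v, twistedAct (finRotate 3) v = v ∧ twistedAct (Equiv.swap 0 1) v - v = b := by
  refine ⟨![-b 4, b 4 + b 0 / 3, b 4 + b 0 / 3, b 4 + b 0 / 3, 0, 0, 0, 0], rfl, ?_⟩
  simp only [twistedAct_finRotate, twistedAct_swap_zero_one, fibreSwap, funext_iff,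
    Fin.forall_fin_succ] at hs hb ⊢
  simp at hs hb ⊢
  omega

lemma exists_eq_sub_of_cocycle (H : Subgroup (Equiv.Perm (Fin 3))) (c : Equiv.Perm (Fin 3) → V)
    (hc : ∀ σ ∈ H, ∀ τ ∈ H, c (σ * τ) = twistedHom σ (c τ) + c σ) :
    ∃ v, ∀ σ ∈ H, twistedHom σ v - v = c σ := by
  have h1 : c 1 = 0 := by
    have := hc 1 H.one_mem 1 H.one_mem
    simpa using this
  by_cases hs : finRotate 3 ∈ H
  · have hs2 := hc _ hs _ hs
    have hs3 := hc _ hs _ (H.mul_mem hs hs)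
    rw [show finRotate 3 * (finRotate 3 * finRotate 3) = 1 by decide, h1, hs2] at hs3
    obtain ⟨v, hv⟩ := exists_finRotate_sub_eq (a := c (finRotate 3)) (by
      rw [map_add, twistedHom_apply, twistedHom_apply] at hs3
      rw [hs3]; abel)
    have key : ∀ w, twistedHom (finRotate 3) w - w = c (finRotate 3) →
        (Equiv.swap 0 1 ∈ H → twistedHom (Equiv.swap 0 1) w - w = c (Equiv.swap 0 1)) →
        ∀ σ ∈ H, twistedHom σ w - w = c σ := by
      intro w hw1 hw2 σ hσ
      have hmul : ∀ σ ∈ H, ∀ τ ∈ H, twistedHom σ w - w = c σ → twistedHom τ w - w = c τ →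
          twistedHom (σ * τ) w - w = c (σ * τ) := by
        intro σ hσ τ hτ h h'
        rw [hc σ hσ τ hτ, ← h, ← h', map_mul, LinearEquiv.mul_apply, map_sub]
        abel
      have hs2 := hmul _ hs _ hs hw1 hw1
      have hcases : ∀ σ : Equiv.Perm (Fin 3), σ = 1 ∨ σ = finRotate 3 ∨
          σ = finRotate 3 * finRotate 3 ∨ σ = 1 * Equiv.swap 0 1 ∨
          σ = finRotate 3 * Equiv.swap 0 1 ∨
          σ = finRotate 3 * finRotate 3 * Equiv.swap 0 1 := by decide
      have hone : twistedHom 1 w - w = c 1 := by simp [h1]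
      have hswap : ∀ ρ ∈ H, twistedHom ρ w - w = c ρ → ρ * Equiv.swap 0 1 ∈ H →
          twistedHom (ρ * Equiv.swap 0 1) w - w = c (ρ * Equiv.swap 0 1) := by
        intro ρ hρ h hm
        have ht := (H.mul_mem_cancel_left hρ).1 hm
        exact hmul ρ hρ _ ht h (hw2 ht)
      rcases hcases σ with rfl | rfl | rfl | rfl | rfl | rfl
      · exact hone
      · exact hw1
      · exact hs2
      · exact hswap _ H.one_mem hone hσ
      · exact hswap _ hs hw1 hσ
      · exact hswap _ (H.mul_mem hs hs) hs2 hσ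
    by_cases ht : Equiv.swap 0 1 ∈ H
    · have htt := hc _ ht _ ht
      rw [Equiv.swap_mul_self, h1] at htt
      have hst := hc _ hs _ ht
      rw [show finRotate 3 * Equiv.swap 0 1 = Equiv.swap 0 1 * (finRotate 3 * finRotate 3) by
        decide, hc _ ht _ (H.mul_mem hs hs), hs2] at hst
      have hcomm : twistedHom (finRotate 3) (twistedHom (Equiv.swap 0 1) v) =
          twistedHom (Equiv.swap 0 1) (twistedHom (finRotate 3) (twistedHom (finRotate 3) v)) := by
        simp only [← LinearEquiv.mul_apply, ← map_mul]
        congr 2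
        decide
      have hsq : twistedHom (Equiv.swap 0 1) (twistedHom (Equiv.swap 0 1) v) = v := by
        rw [← LinearEquiv.mul_apply, ← map_mul, Equiv.swap_mul_self, map_one]
        rfl
      rw [← twistedHom_apply] at hv
      obtain ⟨w, hw1, hw2⟩ := exists_invariant_swap_sub_eq
        (b := c (Equiv.swap 0 1) - (twistedHom (Equiv.swap 0 1) v - v))
        (by
          rw [← twistedHom_apply, map_sub, map_sub, hcomm]
          rw [← hv] at hst
          simp only [map_add, map_sub] at hst
          linear_combination -hst)
        (by
          rw [← twistedHom_apply, map_sub, map_sub, hsq]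
          linear_combination -htt)
      rw [← twistedHom_apply] at hw1 hw2
      refine ⟨v + w, key _ ?_ fun _ => ?_⟩
      · rw [map_add, hw1, ← hv]
        abel
      · rw [map_add]
        linear_combination hw2
    · exact ⟨v, key v hv fun h => absurd h ht⟩
  · by_cases ht : ∃ τ ∈ H, Equiv.Perm.sign τ ≠ 1
    · obtain ⟨τ, hτ, hodd⟩ := ht
      have hinv : ∀ τ : Equiv.Perm (Fin 3), Equiv.Perm.sign τ ≠ 1 → τ * τ = 1 := by decide
      have hττ := hc τ hτ τ hτ
      rw [hinv τ hodd, h1] at hττ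
      obtain ⟨v, hv⟩ := exists_swap_sub_eq hodd (b := c τ) (by
        rw [add_comm]; exact hττ.symm)
      have hcases : ∀ σ τ : Equiv.Perm (Fin 3), Equiv.Perm.sign τ ≠ 1 → σ = 1 ∨ σ = τ ∨
          σ = finRotate 3 ∨ σ * σ = finRotate 3 ∨ σ * τ = finRotate 3 ∨
          τ * σ = finRotate 3 := by decide
      refine ⟨v, fun σ hσ => ?_⟩
      rcases hcases σ τ hodd with rfl | rfl | h | h | h | h
      · simp [h1]
      · exact hv
      · exact absurd (h ▸ hσ) hs
      · exact absurd (h ▸ H.mul_mem hσ hσ) hs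
      · exact absurd (h ▸ H.mul_mem hσ hτ) hs
      · exact absurd (h ▸ H.mul_mem hτ hσ) hs
    · push Not at ht
      have hcases : ∀ σ : Equiv.Perm (Fin 3), Equiv.Perm.sign σ = 1 → σ = 1 ∨
          σ = finRotate 3 ∨ σ * σ = finRotate 3 := by decide
      refine ⟨0, fun σ hσ => ?_⟩
      rcases hcases σ (ht σ hσ) with rfl | rfl | h
      · simp [h1]
      · exact absurd hσ hs
      · exact absurd (h ▸ H.mul_mem hσ hσ) hs

lemma condH1_range : CondH1 twistedHom.range := by
  intro G' hG'
  refine subsingleton_of_forall_eq 0 fun x => ?_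
  induction x using groupCohomology.H1_induction_on with
  | h f =>
  rw [groupCohomology.H1π_eq_zero_iff]
  classical
  have hf := (groupCohomology.mem_cocycles₁_iff _).1 f.2
  obtain ⟨v, hv⟩ := exists_eq_sub_of_cocycle (G'.comap twistedHom)
    (fun σ => if h : twistedHom σ ∈ G' then f ⟨twistedHom σ, h⟩ else 0) (by
      intro σ hσ τ hτ
      have hσ' : twistedHom σ ∈ G' := hσ
      have hτ' : twistedHom τ ∈ G' := hτ
      have hm : twistedHom (σ * τ) ∈ G' := (map_mul twistedHom σ τ) ▸ G'.mul_mem hσ' hτ'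
      simp only [hσ', hτ', hm, dif_pos]
      exact (congrArg f (Subtype.ext (map_mul twistedHom σ τ))).trans (hf ⟨_, hσ'⟩ ⟨_, hτ'⟩))
  refine ⟨v, funext fun g => ?_⟩
  obtain ⟨g, hg⟩ := g
  obtain ⟨σ, rfl⟩ := hG' hg
  have := hv σ hg
  simp only [hg, dif_pos] at this
  exact this

theorem exists_dp2_S3_conic :
    ∃ G : Subgroup LatAut, G ≤ W ∧
      Nonempty (G ≃* Equiv.Perm (Fin 3)) ∧
      (orbs G).ncard = 10 ∧
      {S ∈ orbs G | S.ncard = 2}.ncard = 1 ∧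
      {S ∈ orbs G | S.ncard = 6}.ncard = 9 ∧
      (∀ E ∈ Exc,
        ((orb G E).ncard = 2 → IsCyclic (stab G E) ∧ Nat.card (stab G E) = 3) ∧
        ((orb G E).ncard = 6 → stab G E = ⊥)) ∧
      MinimalAction G ∧
      (∃ C, IsConic C ∧ ∀ g ∈ G, g C = C) ∧
      CondH1 G := by
  refine ⟨twistedHom.range, ?_, ⟨(MonoidHom.ofInjective twistedHom_injective).symm⟩, ?_,
    ?_, ?_, fun E _ => ⟨fun h => ?_, fun h => ?_⟩, minimalAction_range,
    ⟨![1, 0, 0, 0, 0, 0, 0, -1], by simp [IsConic, bil_eq, Kvec], ?_⟩, condH1_range⟩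
  · rintro _ ⟨σ, rfl⟩
    exact ⟨bil_twistedAct σ, twistedAct_Kvec σ⟩
  · rw [orbs_range, Set.ncard_range_of_injective orb_orbitRep_injective]
    simp
  · rw [ncard_orbs_with_ncard]
    decide
  · rw [ncard_orbs_with_ncard]
    decide
  · have hcard := ncard_orb_mul_card_stab twistedHom.range E
    rw [h, card_range_twistedHom] at hcard
    have h3 : Nat.card (stab twistedHom.range E) = 3 := by omega
    have : Fact (Nat.Prime 3) := ⟨Nat.prime_three⟩
    exact ⟨isCyclic_of_prime_card h3, h3⟩
  · have hcard := ncard_orb_mul_card_stab twistedHom.range E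
    rw [h, card_range_twistedHom] at hcard
    exact Subgroup.eq_bot_of_card_eq _ (by omega)
  · have hfix : ∀ σ, twistedAct σ ![1, 0, 0, 0, 0, 0, 0, -1] = ![1, 0, 0, 0, 0, 0, 0, -1] := by
      decide +kernel
    rintro _ ⟨σ, rfl⟩
    exact hfix σ

end
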